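/- arXiv:1904.11212 — 4 statements merged into one kernel-verified Lean document; each statement's English description precedes it below -/
import Mathlib

section
/- Let n ≥ 3 be an integer, let 0 < q ≤ 1 and let x ∈ [0,1]. Then M_n^q(e_1)(x) = x, i.e., for x ∈ [0,1), (∏_{j=0}^n (1 − q^j x)) · Σ_{k=0}^∞ ([k]_q/[n+k]_q) [n+k choose k]_q x^k = x. -/
/-- The `q`-integer `[n]_q = 1 + q + ⋯ + q^{n-1}`. -/
noncomputable def qInt (q : ℝ) (n : ℕ) : ℝ := ∑ k ∈ Finset.range n, q ^ k

/-- The `q`-factorial `[n]_q!`. -/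
noncomputable def qFact (q : ℝ) (n : ℕ) : ℝ := ∏ k ∈ Finset.range n, qInt q (k + 1)

/-- The `q`-binomial coefficient `[m choose r]_q`. -/
noncomputable def qBinom (q : ℝ) (m r : ℕ) : ℝ := qFact q m / (qFact q r * qFact q (m - r))

/-- The `q`-Meyer–König–Zeller operator. -/
noncomputable def MKZ (q : ℝ) (n : ℕ) (f : ℝ → ℝ) (x : ℝ) : ℝ :=
  if x = 1 then f 1
  else (∏ j ∈ Finset.range (n + 1), (1 - q ^ j * x)) *
    ∑' k : ℕ, f (qInt q k / qInt q (n + k)) * qBinom q (n + k) k * x ^ k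

theorem qInt_add (q : ℝ) (m n : ℕ) : qInt q (m + n) = qInt q m + q ^ m * qInt q n := by
  simp only [qInt, Finset.sum_range_add, pow_add, Finset.mul_sum]

theorem qInt_succ_pos {q : ℝ} (hq : 0 < q) (n : ℕ) : 0 < qInt q (n + 1) :=
  Finset.sum_pos (fun _ _ => pow_pos hq _) ⟨0, by simp⟩

theorem qFact_pos {q : ℝ} (hq : 0 < q) (n : ℕ) : 0 < qFact q n :=
  Finset.prod_pos fun k _ => qInt_succ_pos hq k

theorem qFact_succ (q : ℝ) (n : ℕ) : qFact q (n + 1) = qFact q n * qInt q (n + 1) :=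
  Finset.prod_range_succ _ n

theorem qBinom_add_right (q : ℝ) (n k : ℕ) :
    qBinom q (n + k) k = qFact q (n + k) / (qFact q k * qFact q n) := by
  rw [qBinom, Nat.add_sub_cancel]

theorem qBinom_zero_right {q : ℝ} (hq : 0 < q) (n : ℕ) : qBinom q n 0 = 1 := by
  simp [qBinom, show qFact q 0 = 1 from Finset.prod_range_zero _, (qFact_pos hq n).ne']

theorem qBinom_self {q : ℝ} (hq : 0 < q) (n : ℕ) : qBinom q n n = 1 := by
  simp [qBinom, show qFact q 0 = 1 from Finset.prod_range_zero _, (qFact_pos hq n).ne']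

/-- The `q`-Pascal rule. -/
theorem qBinom_succ_add_succ {q : ℝ} (hq : 0 < q) (n k : ℕ) :
    qBinom q (n + 1 + (k + 1)) (k + 1) =
      qBinom q (n + (k + 1)) (k + 1) + q ^ (n + 1) * qBinom q (n + 1 + k) k := by
  have h₁ := (qFact_pos hq n).ne'
  have h₂ := (qFact_pos hq k).ne'
  have h₃ := (qInt_succ_pos hq n).ne'
  have h₄ := (qInt_succ_pos hq k).ne'
  have h := qInt_add q (n + 1) (k + 1)
  simp only [qBinom_add_right]
  rw [← add_assoc (n + 1) k 1, qFact_succ q (n + 1 + k), add_assoc (n + 1) k 1, h,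
    show n + (k + 1) = n + 1 + k by ring, qFact_succ q n, qFact_succ q k]
  field_simp

theorem qBinom_succ_add_eq_sum {q : ℝ} (hq : 0 < q) (n k : ℕ) :
    qBinom q (n + 1 + k) k =
      ∑ i ∈ Finset.range (k + 1), qBinom q (n + i) i * (q ^ (n + 1)) ^ (k - i) := by
  induction k with
  | zero => simp [qBinom_zero_right hq]
  | succ k ih =>
    rw [Finset.sum_range_succ, qBinom_succ_add_succ hq, ih, Finset.mul_sum, add_comm]
    congr 1
    · refine Finset.sum_congr rfl fun i hi => ?_
      rw [Nat.sub_add_comm (Nat.lt_succ_iff.mp (Finset.mem_range.mp hi)), pow_succ]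
      ring
    · simp

theorem hasSum_qBinom_mul_pow {q : ℝ} (hq0 : 0 < q) (hq1 : q ≤ 1) {x : ℝ} (hx0 : 0 ≤ x)
    (hx1 : x < 1) (n : ℕ) :
    HasSum (fun k : ℕ => qBinom q (n + k) k * x ^ k)
      (∏ j ∈ Finset.range (n + 1), (1 - q ^ j * x))⁻¹ := by
  induction n with
  | zero => simpa [qBinom_self hq0] using hasSum_geometric_of_lt_one hx0 hx1
  | succ n ih =>
    have hr0 : 0 ≤ q ^ (n + 1) * x := by positivity
    have hr1 : q ^ (n + 1) * x < 1 :=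
      (mul_le_of_le_one_left hx0 (pow_le_one₀ hq0.le hq1)).trans_lt hx1
    have hg := hasSum_geometric_of_lt_one hr0 hr1
    have hf' : Summable fun k : ℕ => ‖qBinom q (n + k) k * x ^ k‖ := ih.summable.norm
    have hg' : Summable fun k : ℕ => ‖(q ^ (n + 1) * x) ^ k‖ := hg.summable.norm
    have hs := (summable_norm_sum_mul_range_of_summable_norm hf' hg').of_norm.hasSum
    rw [← tsum_mul_tsum_eq_tsum_sum_range_of_summable_norm hf' hg', ih.tsum_eq, hg.tsum_eq] at hs
    rw [Finset.prod_range_succ, mul_inv]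
    refine (congrArg (HasSum · _) (funext fun k => ?_)).mpr hs
    rw [qBinom_succ_add_eq_sum hq0, Finset.sum_mul]
    refine Finset.sum_congr rfl fun i hi => ?_
    rw [← Nat.add_sub_of_le (Nat.lt_succ_iff.mp (Finset.mem_range.mp hi)), pow_add x,
      Nat.add_sub_cancel_left, mul_pow]
    ring

theorem qInt_div_mul_qBinom_succ {q : ℝ} (hq : 0 < q) (n k : ℕ) :
    qInt q (k + 1) / qInt q (n + (k + 1)) * qBinom q (n + (k + 1)) (k + 1) =
      qBinom q (n + k) k := by
  have h₁ := (qFact_pos hq n).ne'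
  have h₂ := (qFact_pos hq k).ne'
  have h₃ := (qInt_succ_pos hq (n + k)).ne'
  have h₄ := (qInt_succ_pos hq k).ne'
  rw [qBinom_add_right, qBinom_add_right, ← add_assoc, qFact_succ, qFact_succ]
  field_simp

theorem hasSum_qInt_div_mul_qBinom_mul_pow {q : ℝ} (hq0 : 0 < q) (hq1 : q ≤ 1) {x : ℝ}
    (hx0 : 0 ≤ x) (hx1 : x < 1) (n : ℕ) :
    HasSum (fun k : ℕ => qInt q k / qInt q (n + k) * qBinom q (n + k) k * x ^ k)
      ((∏ j ∈ Finset.range (n + 1), (1 - q ^ j * x))⁻¹ * x) := by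
  have h0 : qInt q 0 = 0 := Finset.sum_range_zero _
  rw [← hasSum_nat_add_iff' 1]
  simp only [qInt_div_mul_qBinom_succ hq0, pow_succ, ← mul_assoc, Finset.sum_range_one, h0,
    zero_div, zero_mul, sub_zero]
  exact (hasSum_qBinom_mul_pow hq0 hq1 hx0 hx1 n).mul_right x

theorem prod_one_sub_pow_mul_pos {q : ℝ} (hq0 : 0 < q) (hq1 : q ≤ 1) {x : ℝ} (hx0 : 0 ≤ x)
    (hx1 : x < 1) (n : ℕ) : 0 < ∏ j ∈ Finset.range n, (1 - q ^ j * x) :=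
  Finset.prod_pos fun _ _ => sub_pos.mpr <|
    (mul_le_of_le_one_left hx0 (pow_le_one₀ hq0.le hq1)).trans_lt hx1

theorem stmt1 (q : ℝ) (hq0 : 0 < q) (hq1 : q ≤ 1) (n : ℕ) (hn : 3 ≤ n)
    (x : ℝ) (hx : x ∈ Set.Icc (0 : ℝ) 1) :
    MKZ q n (fun t => t) x = x ∧
    (x < 1 →
      (∏ j ∈ Finset.range (n + 1), (1 - q ^ j * x)) *
        ∑' k : ℕ, (qInt q k / qInt q (n + k)) * qBinom q (n + k) k * x ^ k = x) := by
  have main (hx1 : x < 1) :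
      (∏ j ∈ Finset.range (n + 1), (1 - q ^ j * x)) *
        ∑' k : ℕ, (qInt q k / qInt q (n + k)) * qBinom q (n + k) k * x ^ k = x := by
    rw [(hasSum_qInt_div_mul_qBinom_mul_pow hq0 hq1 hx.1 hx1 n).tsum_eq]
    exact mul_inv_cancel_left₀ (prod_one_sub_pow_mul_pos hq0 hq1 hx.1 hx1 _).ne' x
  refine ⟨?_, main⟩
  rw [MKZ]
  split_ifs with h
  · exact h.symm
  · exact main (lt_of_le_of_ne hx.2 h)
end

section
/- Let a < b be real numbers and for each n ∈ ℕ let L_n be a linear operator from C[a,b] into the real-valued bounded functions on [a,b] which is positive (f ≥ 0 on [a,b] implies L_n f ≥ 0 on [a,b]). Assume that Σ_{n=0}^∞ ‖L_n(e_0)‖ yⁿ < ∞ for every y ∈ (0,1), where ‖g‖ = sup_{a≤x≤b} |g(x)| and e_i(x) = x^i. Then for every f ∈ C[a,b] and every y ∈ (0,1) the series Σ_{n=0}^∞ (L_n f − f)(x) yⁿ converges absolutely for each x ∈ [a,b], and the following are equivalent: (i) lim_{y→1⁻} (1−y) ‖Σ_{n=0}^∞ (L_n f − f) yⁿ‖ =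 0 for every f ∈ C[a,b]; (ii) lim_{y→1⁻} (1−y) ‖Σ_{n=0}^∞ (L_n e_i − e_i) yⁿ‖ = 0 for i = 0, 1, 2. -/
open Filter Topology

/-- The monomial `e_i(x) = x^i` as a continuous function on `[a,b]`. -/
noncomputable def mono (a b : ℝ) (i : ℕ) : C(Set.Icc a b, ℝ) :=
  ⟨fun x => (x : ℝ) ^ i, by fun_prop⟩

/-- A continuous function on a compact interval has modulus of continuity dominated by
`ε + K (s - x)^2`. -/
theorem ContinuousMap.exists_abs_sub_le_add_mul_sq {a b : ℝ} (f : C(Set.Icc a b, ℝ)) {ε : ℝ}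
    (hε : 0 < ε) :
    ∃ K, 0 ≤ K ∧ ∀ s x : Set.Icc a b, |f s - f x| ≤ ε + K * ((s : ℝ) - x) ^ 2 := by
  have huc : UniformContinuous f := CompactSpace.uniformContinuous_of_continuous f.continuous
  obtain ⟨δ, hδ, h⟩ := Metric.uniformContinuous_iff.1 huc ε hε
  refine ⟨2 * ‖f‖ / δ ^ 2, by positivity, fun s x => ?_⟩
  by_cases hsx : dist s x < δ
  · have h1 := (h hsx).le
    rw [Real.dist_eq] at h1
    have : 0 ≤ 2 * ‖f‖ / δ ^ 2 * ((s : ℝ) - x) ^ 2 := by positivity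
    linarith
  · rw [not_lt, Subtype.dist_eq, Real.dist_eq] at hsx
    have h1 : |f s - f x| ≤ 2 * ‖f‖ := by
      have hs := f.norm_coe_le_norm s
      have hx := f.norm_coe_le_norm x
      rw [Real.norm_eq_abs] at hs hx
      linarith [abs_sub (f s) (f x)]
    have h2 : δ ^ 2 ≤ ((s : ℝ) - x) ^ 2 := by
      rw [← sq_abs ((s : ℝ) - x)]
      gcongr
    have h3 : 2 * ‖f‖ ≤ 2 * ‖f‖ / δ ^ 2 * ((s : ℝ) - x) ^ 2 := by
      rw [div_mul_eq_mul_div, le_div_iff₀ (by positivity)]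
      gcongr
    linarith

theorem LinearMap.mono_of_nonneg {X : Type*} [TopologicalSpace X] (P : C(X, ℝ) →ₗ[ℝ] ℝ)
    (hP : ∀ f : C(X, ℝ), (∀ x, 0 ≤ f x) → 0 ≤ P f) {f g : C(X, ℝ)} (hfg : ∀ x, f x ≤ g x) :
    P f ≤ P g := by
  have := hP (g - f) fun x => sub_nonneg.2 (hfg x)
  rwa [map_sub, sub_nonneg] at this

theorem LinearMap.abs_apply_le_of_nonneg {X : Type*} [TopologicalSpace X] (P : C(X, ℝ) →ₗ[ℝ] ℝ)
    (hP : ∀ f : C(X, ℝ), (∀ x, 0 ≤ f x) → 0 ≤ P f) {f g : C(X, ℝ)} (hfg : ∀ x, |f x| ≤ g x) :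
    |P f| ≤ P g := by
  rw [abs_le]
  refine ⟨?_, P.mono_of_nonneg hP fun x => (le_abs_self _).trans (hfg x)⟩
  rw [← map_neg]
  exact P.mono_of_nonneg hP fun x => neg_le.1 ((neg_le_abs _).trans (hfg x))

/-- The quantitative Korovkin estimate for a single positive functional. -/
theorem korovkin_estimate {a b : ℝ} (f : C(Set.Icc a b, ℝ)) {ε K : ℝ}
    (hε : 0 ≤ ε) (hK : 0 ≤ K)
    (hf : ∀ s x : Set.Icc a b, |f s - f x| ≤ ε + K * ((s : ℝ) - x) ^ 2)
    (P : C(Set.Icc a b, ℝ) →ₗ[ℝ] ℝ)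
    (hP : ∀ f : C(Set.Icc a b, ℝ), (∀ x, 0 ≤ f x) → 0 ≤ P f) (x : Set.Icc a b)
    {c d₀ d₁ d₂ : ℝ} (hc : |(x : ℝ)| ≤ c)
    (h₀ : |P (mono a b 0) - mono a b 0 x| ≤ d₀) (h₁ : |P (mono a b 1) - mono a b 1 x| ≤ d₁)
    (h₂ : |P (mono a b 2) - mono a b 2 x| ≤ d₂) :
    |P f - f x| ≤ ε * (1 + d₀) + K * (d₂ + 2 * c * d₁ + c ^ 2 * d₀) + ‖f‖ * d₀ := by
  have key : |P (f - f x • mono a b 0)| ≤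
      P (ε • mono a b 0 +
        K • (mono a b 2 - (2 * (x : ℝ)) • mono a b 1 + (x : ℝ) ^ 2 • mono a b 0)) := by
    refine P.abs_apply_le_of_nonneg hP fun s => ?_
    have := hf s x
    simp only [mono, ContinuousMap.sub_apply, ContinuousMap.add_apply, ContinuousMap.smul_apply,
      ContinuousMap.coe_mk, smul_eq_mul, pow_zero, mul_one, pow_one]
    calc _ ≤ _ := this
      _ = _ := by ring
  simp only [map_sub, map_add, map_smul, smul_eq_mul] at key
  rw [show mono a b 0 x = 1 from pow_zero _] at h₀
  rw [show mono a b 1 x = x from pow_one _] at h₁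
  rw [show mono a b 2 x = (x : ℝ) ^ 2 from rfl] at h₂
  set p₀ := P (mono a b 0)
  set p₁ := P (mono a b 1)
  set p₂ := P (mono a b 2)
  have hc0 : 0 ≤ c := (abs_nonneg _).trans hc
  have e1 : -((x : ℝ) * (p₁ - x)) ≤ c * d₁ := by
    calc _ ≤ |(x : ℝ) * (p₁ - x)| := neg_le_abs _
      _ = |(x : ℝ)| * |p₁ - x| := abs_mul _ _
      _ ≤ c * d₁ := by gcongr
  have e0 : (x : ℝ) ^ 2 * (p₀ - 1) ≤ c ^ 2 * d₀ := by
    calc _ ≤ |(x : ℝ) ^ 2 * (p₀ - 1)| := le_abs_self _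
      _ = |(x : ℝ)| ^ 2 * |p₀ - 1| := by rw [abs_mul, abs_pow]
      _ ≤ c ^ 2 * d₀ := by gcongr
  have e2 : p₂ - (x : ℝ) ^ 2 ≤ d₂ := (le_abs_self _).trans h₂
  have e3 : p₂ - 2 * x * p₁ + (x : ℝ) ^ 2 * p₀ ≤ d₂ + 2 * c * d₁ + c ^ 2 * d₀ := by
    linarith
  have e4 : ε * p₀ ≤ ε * (1 + d₀) := by
    gcongr
    linarith [le_abs_self (p₀ - 1)]
  have e5 : |f x * (p₀ - 1)| ≤ ‖f‖ * d₀ := by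
    rw [abs_mul]
    have := f.norm_coe_le_norm x
    rw [Real.norm_eq_abs] at this
    gcongr
  have e6 := mul_le_mul_of_nonneg_left e3 hK
  calc |P f - f x| = |(P f - f x * p₀) + f x * (p₀ - 1)| := by ring_nf
    _ ≤ |P f - f x * p₀| + |f x * (p₀ - 1)| := abs_add_le _ _
    _ ≤ _ := by linarith

theorem stmt7 (a b : ℝ) (hab : a < b)
    (L : ℕ → C(Set.Icc a b, ℝ) → (Set.Icc a b → ℝ))
    -- each `L n` is linear
    (hadd : ∀ n f g, L n (f + g) = L n f + L n g)
    (hsmul : ∀ n (c : ℝ) f, L n (c • f) = c • L n f)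
    -- each `L n` is positive
    (hpos : ∀ n f, (∀ x, 0 ≤ f x) → ∀ x, 0 ≤ L n f x)
    -- each `L n` maps into the bounded functions on `[a,b]`
    (hbdd : ∀ n f, ∃ M : ℝ, ∀ x, |L n f x| ≤ M)
    -- `∑ ‖L_n e₀‖ yⁿ < ∞` for every `y ∈ (0,1)`
    (hsum : ∀ y ∈ Set.Ioo (0 : ℝ) 1,
      Summable (fun n : ℕ => (⨆ x : Set.Icc a b, |L n (mono a b 0) x|) * y ^ n)) :
    (∀ f : C(Set.Icc a b, ℝ), ∀ y ∈ Set.Ioo (0 : ℝ) 1, ∀ x : Set.Icc a b,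
      Summable (fun n : ℕ => |(L n f x - f x) * y ^ n|)) ∧
    ((∀ f : C(Set.Icc a b, ℝ),
        Tendsto (fun y : ℝ => (1 - y) * ⨆ x : Set.Icc a b, |∑' n : ℕ, (L n f x - f x) * y ^ n|)
          (𝓝[<] 1) (𝓝 0)) ↔
      (∀ i ≤ 2,
        Tendsto (fun y : ℝ =>
            (1 - y) * ⨆ x : Set.Icc a b, |∑' n : ℕ, (L n (mono a b i) x - mono a b i x) * y ^ n|)
          (𝓝[<] 1) (𝓝 0))) := by
  set S : ℕ → ℝ := fun n => ⨆ x : Set.Icc a b, |L n (mono a b 0) x|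
  have hLS (n : ℕ) (f : C(Set.Icc a b, ℝ)) (x : Set.Icc a b) : |L n f x| ≤ ‖f‖ * S n := by
    let P : C(Set.Icc a b, ℝ) →ₗ[ℝ] ℝ :=
      { toFun := fun f => L n f x
        map_add' := fun f g => by rw [hadd]; rfl
        map_smul' := fun c f => by rw [hsmul]; rfl }
    have h1 : |P f| ≤ P (‖f‖ • mono a b 0) :=
      P.abs_apply_le_of_nonneg (fun g hg => hpos n g hg x) fun s => by
        simpa [mono] using f.norm_coe_le_norm s
    rw [map_smul, smul_eq_mul] at h1
    obtain ⟨M, hM⟩ := hbdd n (mono a b 0)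
    have h2 : L n (mono a b 0) x ≤ S n :=
      (le_abs_self _).trans (le_ciSup (f := fun x => |L n (mono a b 0) x|)
        ⟨M, by rintro _ ⟨z, rfl⟩; exact hM z⟩ x)
    exact h1.trans (mul_le_mul_of_nonneg_left h2 (norm_nonneg f))
  have hle (f : C(Set.Icc a b, ℝ)) (y : ℝ) (hy : y ∈ Set.Ioo (0 : ℝ) 1) (x : Set.Icc a b) (n : ℕ) :
      ‖(L n f x - f x) * y ^ n‖ ≤ ‖f‖ * (S n * y ^ n) + ‖f‖ * y ^ n := by
    have hyn : 0 ≤ y ^ n := pow_nonneg hy.1.le n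
    rw [norm_mul, Real.norm_eq_abs, Real.norm_of_nonneg hyn]
    have hx := f.norm_coe_le_norm x
    rw [Real.norm_eq_abs] at hx
    calc |L n f x - f x| * y ^ n ≤ (‖f‖ * S n + ‖f‖) * y ^ n := by
          gcongr
          exact (abs_sub _ _).trans (add_le_add (hLS n f x) hx)
      _ = _ := by ring
  have hgeom (y : ℝ) (hy : y ∈ Set.Ioo (0 : ℝ) 1) : Summable fun n : ℕ => y ^ n :=
    summable_geometric_of_lt_one hy.1.le hy.2
  have hmaj (f : C(Set.Icc a b, ℝ)) (y : ℝ) (hy : y ∈ Set.Ioo (0 : ℝ) 1) :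
      Summable fun n : ℕ => ‖f‖ * (S n * y ^ n) + ‖f‖ * y ^ n :=
    ((hsum y hy).mul_left _).add ((hgeom y hy).mul_left _)
  have hsb (f : C(Set.Icc a b, ℝ)) (y : ℝ) (hy : y ∈ Set.Ioo (0 : ℝ) 1) (x : Set.Icc a b) :
      Summable fun n : ℕ => (L n f x - f x) * y ^ n :=
    .of_norm_bounded (hmaj f y hy) (hle f y hy x)
  have hsL (f : C(Set.Icc a b, ℝ)) (y : ℝ) (hy : y ∈ Set.Ioo (0 : ℝ) 1) (x : Set.Icc a b) :
      Summable fun n : ℕ => L n f x * y ^ n := by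
    refine ((hsb f y hy x).add ((hgeom y hy).mul_left (f x))).congr fun n => ?_
    ring
  refine ⟨fun f y hy x => (hsb f y hy x).abs, fun h i _ => h _, fun h f => ?_⟩
  set D : C(Set.Icc a b, ℝ) → ℝ → ℝ := fun f y =>
    (1 - y) * ⨆ x : Set.Icc a b, |∑' n : ℕ, (L n f x - f x) * y ^ n| with hD
  have hD0 : Tendsto (D (mono a b 0)) (𝓝[<] 1) (𝓝 0) := h 0 (by norm_num)
  have hD1 : Tendsto (D (mono a b 1)) (𝓝[<] 1) (𝓝 0) := h 1 (by norm_num)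
  have hD2 : Tendsto (D (mono a b 2)) (𝓝[<] 1) (𝓝 0) := h 2 le_rfl
  have hmean (f : C(Set.Icc a b, ℝ)) (y : ℝ) (hy : y ∈ Set.Ioo (0 : ℝ) 1) (x : Set.Icc a b) :
      (1 - y) * ∑' n : ℕ, L n f x * y ^ n - f x =
        (1 - y) * ∑' n : ℕ, (L n f x - f x) * y ^ n := by
    have hy1 : 1 - y ≠ 0 := (sub_pos.2 hy.2).ne'
    simp only [sub_mul (L _ f x)]
    rw [(hsL f y hy x).tsum_sub ((hgeom y hy).mul_left _), tsum_mul_left,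
      tsum_geometric_of_lt_one hy.1.le hy.2]
    field_simp
  have hDle (f : C(Set.Icc a b, ℝ)) (y : ℝ) (hy : y ∈ Set.Ioo (0 : ℝ) 1) (x : Set.Icc a b) :
      |(1 - y) * ∑' n : ℕ, L n f x * y ^ n - f x| ≤ D f y := by
    have hy1 : 0 < 1 - y := sub_pos.2 hy.2
    rw [hmean f y hy x, abs_mul, abs_of_pos hy1]
    refine mul_le_mul_of_nonneg_left ?_ hy1.le
    refine le_ciSup (f := fun x => |∑' n : ℕ, (L n f x - f x) * y ^ n|)
      ⟨∑' n : ℕ, (‖f‖ * (S n * y ^ n) + ‖f‖ * y ^ n), ?_⟩ x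
    rintro _ ⟨z, rfl⟩
    exact tsum_of_norm_bounded (hmaj f y hy).hasSum (hle f y hy z)
  have hne : Nonempty (Set.Icc a b) := ⟨⟨a, le_rfl, hab.le⟩⟩
  set c := max |a| |b|
  have hmain (ε K : ℝ) (hε : 0 ≤ ε) (hK : 0 ≤ K)
      (hf : ∀ s x : Set.Icc a b, |f s - f x| ≤ ε + K * ((s : ℝ) - x) ^ 2)
      (y : ℝ) (hy : y ∈ Set.Ioo (0 : ℝ) 1) :
      D f y ≤ ε * (1 + D (mono a b 0) y) + K * (D (mono a b 2) y + 2 * c * D (mono a b 1) y +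
        c ^ 2 * D (mono a b 0) y) + ‖f‖ * D (mono a b 0) y := by
    have hy1 : 0 < 1 - y := sub_pos.2 hy.2
    rw [hD]
    dsimp only
    rw [Real.mul_iSup_of_nonneg hy1.le]
    refine ciSup_le fun x => ?_
    rw [← abs_of_pos hy1, ← abs_mul, abs_of_pos hy1, ← hmean f y hy x]
    let P : C(Set.Icc a b, ℝ) →ₗ[ℝ] ℝ :=
      { toFun := fun f => (1 - y) * ∑' n : ℕ, L n f x * y ^ n
        map_add' := fun f g => by
          simp only [hadd, Pi.add_apply, add_mul]
          rw [(hsL f y hy x).tsum_add (hsL g y hy x), mul_add]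
        map_smul' := fun k f => by
          simp only [hsmul, Pi.smul_apply, smul_eq_mul, mul_assoc, tsum_mul_left,
            RingHom.id_apply]
          ring }
    exact korovkin_estimate f hε hK hf P
      (fun g hg => mul_nonneg hy1.le
        (tsum_nonneg fun n => mul_nonneg (hpos n g hg x) (pow_nonneg hy.1.le n)))
      x (abs_le_max_abs_abs x.2.1 x.2.2) (hDle _ y hy x) (hDle _ y hy x) (hDle _ y hy x)
  have hIoo : ∀ᶠ y : ℝ in 𝓝[<] 1, y ∈ Set.Ioo (0 : ℝ) 1 := Ioo_mem_nhdsLT one_pos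
  refine tendsto_order.2 ⟨fun r hr => ?_, fun r hr => ?_⟩
  · filter_upwards [hIoo] with y hy
    exact hr.trans_le (mul_nonneg (sub_pos.2 hy.2).le (Real.iSup_nonneg fun x => abs_nonneg _))
  · obtain ⟨K, hK, hf⟩ := f.exists_abs_sub_le_add_mul_sq (half_pos hr)
    have hlim : Tendsto (fun y => r / 2 * (1 + D (mono a b 0) y) +
        K * (D (mono a b 2) y + 2 * c * D (mono a b 1) y + c ^ 2 * D (mono a b 0) y) +
        ‖f‖ * D (mono a b 0) y) (𝓝[<] 1) (𝓝 (r / 2 * (1 + 0) +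
        K * (0 + 2 * c * 0 + c ^ 2 * 0) + ‖f‖ * 0)) :=
      (((hD0.const_add 1).const_mul _).add
        (((hD2.add (hD1.const_mul _)).add (hD0.const_mul _)).const_mul K)).add
        (hD0.const_mul _)
    filter_upwards [hIoo, hlim.eventually_lt_const (u := r) (by linarith)] with y hy hlt
    exact (hmain _ K (half_pos hr).le hK hf y hy).trans_lt hlt
end

section
/- Define the real sequence (a_n)_{n≥3} by a_n = 1 if n is a perfect cube (n = m³ for some integer m) and a_n = 1/(n−1) otherwise. Then (a_n)_{n≥3} is Abel null, i.e., Σ_{n=3}^∞ a_n yⁿ converges for every y ∈ (0,1) and lim_{y→1⁻} (1−y) Σ_{n=3}^∞ a_n yⁿ = 0. -/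
open Filter Topology

open scoped Classical in
/-- `a n = 1` if `n` is a perfect cube, and `a n = 1/(n-1)` otherwise. -/
noncomputable def cubeSeq (n : ℕ) : ℝ :=
  if ∃ m : ℤ, m ^ 3 = (n : ℤ) then 1 else 1 / ((n : ℝ) - 1)

theorem cubeSeq_nonneg (n : ℕ) : 0 ≤ cubeSeq n := by
  unfold cubeSeq
  split_ifs with h
  · exact zero_le_one
  · have hn : n ≠ 0 := by
      rintro rfl
      exact h ⟨0, by simp⟩
    have hn' : (1 : ℝ) ≤ n := by exact_mod_cast Nat.one_le_iff_ne_zero.mpr hn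
    exact one_div_nonneg.mpr (by linarith)

theorem summable_indicator_range_cube :
    Summable ((Set.range fun m : ℕ => m ^ 3).indicator fun n : ℕ => 1 / ((n : ℝ) + 1)) := by
  have hinj : Function.Injective fun m : ℕ => m ^ 3 := Nat.pow_left_injective (by norm_num)
  rw [← hinj.summable_iff fun n hn => Set.indicator_of_notMem hn _]
  have hs : Summable fun m : ℕ => 1 / ((m : ℝ) ^ 3) :=
    Real.summable_one_div_nat_pow.mpr (by norm_num)
  rw [← summable_nat_add_iff 1] at hs ⊢
  refine hs.of_norm_bounded fun m => ?_
  simp only [Function.comp_apply]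
  rw [Set.indicator_of_mem (Set.mem_range_self (f := fun m : ℕ => m ^ 3) (m + 1)),
    Real.norm_of_nonneg (by positivity)]
  push_cast
  gcongr
  linarith

theorem cubeSeq_div_le (n : ℕ) :
    cubeSeq n / ((n : ℝ) + 1) ≤
      (Set.range fun m : ℕ => m ^ 3).indicator (fun n : ℕ => 1 / ((n : ℝ) + 1)) n +
        3 * (1 / ((n : ℝ) + 1) ^ 2) := by
  unfold cubeSeq
  split_ifs with h
  · obtain ⟨m, hm⟩ := h
    have hm0 : 0 ≤ m := by
      by_contra! hneg
      have := Odd.pow_neg (n := 3) (by decide) hneg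
      omega
    lift m to ℕ using hm0
    have hmem : n ∈ Set.range fun m : ℕ => m ^ 3 := ⟨m, by exact_mod_cast hm⟩
    rw [Set.indicator_of_mem hmem]
    have : 0 ≤ 3 * (1 / ((n : ℝ) + 1) ^ 2) := by positivity
    linarith
  · have hn : 2 ≤ n := by
      by_contra! hlt
      interval_cases n
      · exact h ⟨0, by simp⟩
      · exact h ⟨1, by simp⟩
    have hn' : (2 : ℝ) ≤ n := by exact_mod_cast hn
    have hpos : (0 : ℝ) < n - 1 := by linarith
    have hind : 0 ≤ (Set.range fun m : ℕ => m ^ 3).indicator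
        (fun n : ℕ => 1 / ((n : ℝ) + 1)) n := Set.indicator_nonneg (fun _ _ => by positivity) _
    have hle : 1 / ((n : ℝ) - 1) / (n + 1) ≤ 3 * (1 / ((n : ℝ) + 1) ^ 2) := by
      rw [div_div, mul_one_div, div_le_div_iff₀ (by positivity) (by positivity)]
      nlinarith
    linarith

theorem summable_cubeSeq_div : Summable fun n : ℕ => cubeSeq n / ((n : ℝ) + 1) := by
  have hs : Summable fun n : ℕ => 1 / ((n : ℝ) ^ 2) :=
    Real.summable_one_div_nat_pow.mpr one_lt_two
  have hs' : Summable fun n : ℕ => 1 / ((n : ℝ) + 1) ^ 2 := by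
    simpa using (summable_nat_add_iff 1).mpr hs
  exact (summable_indicator_range_cube.add (hs'.mul_left 3)).of_nonneg_of_le
    (fun n => div_nonneg (cubeSeq_nonneg n) (by positivity)) cubeSeq_div_le

theorem one_sub_mul_pow_le {y : ℝ} (h0 : 0 ≤ y) (h1 : y ≤ 1) (n : ℕ) :
    (1 - y) * y ^ n ≤ 1 / ((n : ℝ) + 1) := by
  rw [le_div_iff₀ (by positivity)]
  have hsum : ((n : ℝ) + 1) * y ^ n ≤ ∑ k ∈ Finset.range (n + 1), y ^ k := by
    have := Finset.card_nsmul_le_sum (Finset.range (n + 1)) (fun k => y ^ k) (y ^ n)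
      fun k hk => pow_le_pow_of_le_one h0 h1 (Nat.lt_succ_iff.mp (Finset.mem_range.mp hk))
    simpa using this
  calc (1 - y) * y ^ n * ((n : ℝ) + 1) = (1 - y) * (((n : ℝ) + 1) * y ^ n) := by ring
    _ ≤ (1 - y) * ∑ k ∈ Finset.range (n + 1), y ^ k :=
        mul_le_mul_of_nonneg_left hsum (sub_nonneg.mpr h1)
    _ = 1 - y ^ (n + 1) := mul_neg_geom_sum y (n + 1)
    _ ≤ 1 := sub_le_self _ (pow_nonneg h0 _)

theorem norm_one_sub_mul_cubeSeq_mul_pow_le {y : ℝ} (h0 : 0 ≤ y) (h1 : y ≤ 1) (n : ℕ) :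
    ‖(1 - y) * (cubeSeq n * y ^ n)‖ ≤ cubeSeq n / ((n : ℝ) + 1) := by
  have ha := cubeSeq_nonneg n
  rw [Real.norm_of_nonneg (mul_nonneg (sub_nonneg.mpr h1) (mul_nonneg ha (pow_nonneg h0 n))),
    mul_left_comm, div_eq_mul_one_div]
  exact mul_le_mul_of_nonneg_left (one_sub_mul_pow_le h0 h1 n) ha

theorem stmt11 :
    (∀ y ∈ Set.Ioo (0 : ℝ) 1, Summable (fun n : ℕ => cubeSeq (n + 3) * y ^ (n + 3))) ∧
    Tendsto (fun y : ℝ => (1 - y) * ∑' n : ℕ, cubeSeq (n + 3) * y ^ (n + 3))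
      (𝓝[<] 1) (𝓝 0) := by
  have hs := (summable_nat_add_iff 3).mpr summable_cubeSeq_div
  constructor
  · rintro y ⟨h0, h1⟩
    rw [← summable_mul_left_iff (sub_ne_zero.mpr h1.ne')]
    exact hs.of_norm_bounded
      fun n => norm_one_sub_mul_cubeSeq_mul_pow_le h0.le h1.le (n + 3)
  · simp_rw [← tsum_mul_left]
    rw [← tsum_zero (α := ℝ) (β := ℕ)]
    refine tendsto_tsum_of_dominated_convergence hs (fun n => ?_) ?_
    · have hc : Continuous fun y : ℝ => (1 - y) * (cubeSeq (n + 3) * y ^ (n + 3)) := by fun_prop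
      simpa using (hc.tendsto 1).mono_left nhdsWithin_le_nhds
    · filter_upwards [Ioo_mem_nhdsLT (zero_lt_one' ℝ)] with y hy n
      exact norm_one_sub_mul_cubeSeq_mul_pow_le hy.1.le hy.2.le (n + 3)
end

section
/- Define the real sequence (a_n)_{n≥3} by a_n = 1 if n is a prime number and a_n = 2/(n−1) otherwise. Then (a_n)_{n≥3} is Abel null, i.e., Σ_{n=3}^∞ a_n yⁿ converges for every y ∈ (0,1) and lim_{y→1⁻} (1−y) Σ_{n=3}^∞ a_n yⁿ = 0. -/
open Filter Topology

/-- `a n = 1` if `n` is prime, and `a n = 2/(n-1)` otherwise. -/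
noncomputable def primeSeq (n : ℕ) : ℝ :=
  if Nat.Prime n then 1 else 2 / ((n : ℝ) - 1)

/-- Power series with coefficients in `[0, 1]` converge on `(0, 1)`. -/
theorem summable_mul_pow_of_mem_Icc {c : ℕ → ℝ} (hc : ∀ n, c n ∈ Set.Icc (0 : ℝ) 1)
    {y : ℝ} (hy : y ∈ Set.Ioo (0 : ℝ) 1) : Summable (fun n => c n * y ^ n) := by
  refine Summable.of_nonneg_of_le (fun n => mul_nonneg (hc n).1 (pow_nonneg hy.1.le n))
    (fun n => ?_) (summable_geometric_of_lt_one hy.1.le hy.2)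
  exact mul_le_of_le_one_left (pow_nonneg hy.1.le n) (hc n).2

/-- If the partial sums of a `[0, 1]`-valued sequence are at most `ε n + C`, then so is the
corresponding Abel mean, with `1 / (1 - y)` in place of `n`. -/
theorem one_sub_mul_tsum_le_of_sum_range_le {c : ℕ → ℝ} (hc : ∀ n, c n ∈ Set.Icc (0 : ℝ) 1)
    {ε C y : ℝ} (hS : ∀ n : ℕ, ∑ k ∈ Finset.range n, c k ≤ ε * n + C)
    (hy : y ∈ Set.Ioo (0 : ℝ) 1) :
    y * ((1 - y) * ∑' n, c n * y ^ n) ≤ ε * y + C * (1 - y) := by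
  have hpow (n : ℕ) : 0 ≤ y ^ n := pow_nonneg hy.1.le n
  have hy1 : 0 < 1 - y := sub_pos.2 hy.2
  have hlin : HasSum (fun n : ℕ => (ε * n + C) * y ^ n)
      (ε * (y / (1 - y) ^ 2) + C * (1 - y)⁻¹) := by
    have h1 := (hasSum_coe_mul_geometric_of_norm_lt_one (r := y)
      (by rw [Real.norm_of_nonneg hy.1.le]; exact hy.2)).mul_left ε
    have h2 := (hasSum_geometric_of_lt_one hy.1.le hy.2).mul_left C
    refine (h1.add h2).congr_fun ?_
    intro n
    ring
  set S : ℕ → ℝ := fun n => ∑ k ∈ Finset.range n, c k with hSdef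
  have hT : Summable (fun n => S n * y ^ n) :=
    Summable.of_nonneg_of_le
      (fun n => mul_nonneg (Finset.sum_nonneg fun k _ => (hc k).1) (hpow n))
      (fun n => mul_le_mul_of_nonneg_right (hS n) (hpow n)) hlin.summable
  have hle : ∑' n, S n * y ^ n ≤ ε * (y / (1 - y) ^ 2) + C * (1 - y)⁻¹ := by
    rw [← hlin.tsum_eq]
    exact hT.tsum_le_tsum (fun n => mul_le_mul_of_nonneg_right (hS n) (hpow n)) hlin.summable
  have habel : ∑' n, S n * y ^ n = y * ∑' n, S n * y ^ n + y * ∑' n, c n * y ^ n := by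
    rw [← tsum_mul_left, ← tsum_mul_left, hT.tsum_eq_zero_add,
      ← (hT.mul_left y).tsum_add ((summable_mul_pow_of_mem_Icc hc hy).mul_left y)]
    simp only [hSdef, Finset.range_zero, Finset.sum_empty, zero_mul, zero_add]
    refine tsum_congr fun n => ?_
    rw [Finset.sum_range_succ]
    ring
  calc y * ((1 - y) * ∑' n, c n * y ^ n) = (1 - y) ^ 2 * ∑' n, S n * y ^ n := by
        linear_combination (-(1 - y)) * habel
    _ ≤ (1 - y) ^ 2 * (ε * (y / (1 - y) ^ 2) + C * (1 - y)⁻¹) := by gcongr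
    _ = ε * y + C * (1 - y) := by field_simp

/-- A `[0, 1]`-valued sequence whose partial sums are `o(n)` is Abel null. -/
theorem tendsto_one_sub_mul_tsum_of_isLittleO {c : ℕ → ℝ}
    (hc : ∀ n, c n ∈ Set.Icc (0 : ℝ) 1)
    (hS : (fun n : ℕ => ∑ k ∈ Finset.range n, c k) =o[atTop] (fun n : ℕ => (n : ℝ))) :
    Tendsto (fun y : ℝ => y * ((1 - y) * ∑' n, c n * y ^ n)) (𝓝[<] 1) (𝓝 0) := by
  have hmem : ∀ᶠ y : ℝ in 𝓝[<] 1, y ∈ Set.Ioo (0 : ℝ) 1 := Ioo_mem_nhdsLT one_pos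
  refine tendsto_order.2 ⟨fun a ha => ?_, fun a ha => ?_⟩
  · filter_upwards [hmem] with y hy
    refine ha.trans_le (mul_nonneg hy.1.le (mul_nonneg (sub_pos.2 hy.2).le ?_))
    exact tsum_nonneg fun n => mul_nonneg (hc n).1 (pow_nonneg hy.1.le n)
  · obtain ⟨N, hN⟩ := eventually_atTop.1 (hS.bound (half_pos ha))
    have hbound (n : ℕ) : ∑ k ∈ Finset.range n, c k ≤ a / 2 * n + N := by
      rcases le_total N n with h | h
      · have := (le_abs_self _).trans (hN n h)
        rw [Real.norm_of_nonneg n.cast_nonneg] at this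
        linarith [N.cast_nonneg (α := ℝ)]
      · have h1 : ∑ k ∈ Finset.range n, c k ≤ n := by
          simpa using Finset.sum_le_sum fun k (_ : k ∈ Finset.range n) => (hc k).2
        have h2 : (n : ℝ) ≤ N := by exact_mod_cast h
        have : 0 ≤ a / 2 * n := by positivity
        linarith
    have hlim : Tendsto (fun y : ℝ => a / 2 * y + N * (1 - y)) (𝓝[<] 1) (𝓝 (a / 2)) := by
      have : Continuous (fun y : ℝ => a / 2 * y + N * (1 - y)) := by fun_prop
      simpa using (this.tendsto 1).mono_left nhdsWithin_le_nhds
    filter_upwards [hmem, hlim.eventually_lt_const (half_lt_self ha)] with y hy hlt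
    exact (one_sub_mul_tsum_le_of_sum_range_le hc hbound hy).trans_lt hlt

theorem primeCounting_isLittleO :
    (fun n : ℕ => (n.primeCounting : ℝ)) =o[atTop] (fun n : ℕ => (n : ℝ)) := by
  have hO : (fun n : ℕ => (n.primeCounting : ℝ)) =O[atTop]
      (fun n : ℕ => (n : ℝ) * (Real.log n)⁻¹) := by
    refine Asymptotics.IsBigO.of_bound (Real.log 4 + 1) ?_
    filter_upwards [tendsto_natCast_atTop_atTop.eventually
      (Chebyshev.eventually_primeCounting_le one_pos)] with n hn
    rw [Nat.floor_natCast] at hn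
    rw [Real.norm_of_nonneg (Nat.cast_nonneg _), Real.norm_of_nonneg
      (mul_nonneg n.cast_nonneg (inv_nonneg.2 (Real.log_natCast_nonneg n))), ← mul_assoc,
      ← div_eq_mul_inv]
    exact hn
  refine hO.trans_isLittleO ?_
  have hlog : (fun n : ℕ => (Real.log n)⁻¹) =o[atTop] (fun _ : ℕ => (1 : ℝ)) :=
    (Asymptotics.isLittleO_one_iff ℝ).2
      (Real.tendsto_log_atTop.comp tendsto_natCast_atTop_atTop).inv_tendsto_atTop
  simpa using (Asymptotics.isBigO_refl (fun n : ℕ => (n : ℝ)) atTop).mul_isLittleO hlog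

theorem primeSeq_add_three_mem_Icc (n : ℕ) : primeSeq (n + 3) ∈ Set.Icc (0 : ℝ) 1 := by
  have hn : (0 : ℝ) ≤ n := n.cast_nonneg
  unfold primeSeq
  push_cast
  split_ifs
  · simp
  · exact ⟨div_nonneg zero_le_two (by linarith), (div_le_one (by linarith)).2 (by linarith)⟩

theorem primeSeq_add_three_le (n : ℕ) :
    primeSeq (n + 3) ≤ (if Nat.Prime (3 + n) then 1 else 0) + 2 * (1 / ((n : ℝ) + 1)) := by
  have hn : (0 : ℝ) ≤ n := n.cast_nonneg
  unfold primeSeq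
  rw [add_comm 3 n]
  push_cast
  split_ifs
  · have : 0 ≤ 2 * (1 / ((n : ℝ) + 1)) := by positivity
    linarith
  · rw [zero_add, mul_one_div]
    gcongr
    linarith

theorem sum_primeSeq_add_three_isLittleO :
    (fun n : ℕ => ∑ k ∈ Finset.range n, primeSeq (k + 3)) =o[atTop]
      (fun n : ℕ => (n : ℝ)) := by
  have h1 : (fun n : ℕ => ((n + 3).primeCounting : ℝ)) =o[atTop] (fun n : ℕ => (n : ℝ)) := by
    refine (primeCounting_isLittleO.comp_tendsto (tendsto_add_atTop_nat 3)).trans_isBigO ?_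
    refine Asymptotics.IsBigO.of_bound 4 ?_
    filter_upwards [eventually_ge_atTop 1] with n hn
    have : (1 : ℝ) ≤ n := by exact_mod_cast hn
    simp only [Function.comp_apply, Real.norm_natCast]
    push_cast
    linarith
  have h2 : (fun n : ℕ => ∑ k ∈ Finset.range n, 2 * (1 / ((k : ℝ) + 1))) =o[atTop]
      (fun n : ℕ => (n : ℝ)) :=
    Asymptotics.isLittleO_sum_range_of_tendsto_zero
      (by simpa using tendsto_one_div_add_atTop_nhds_zero_nat.const_mul (2 : ℝ))
  refine Asymptotics.IsBigO.trans_isLittleO (.of_norm_le fun n => ?_) (h1.add h2)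
  rw [Real.norm_of_nonneg (Finset.sum_nonneg fun k _ => (primeSeq_add_three_mem_Icc k).1)]
  refine (Finset.sum_le_sum fun k _ => primeSeq_add_three_le k).trans ?_
  rw [Finset.sum_add_distrib, Finset.sum_boole, ← Nat.count_eq_card_filter_range]
  gcongr
  calc Nat.count (fun k => Nat.Prime (3 + k)) n ≤ Nat.count Nat.Prime (3 + n) := by
        rw [Nat.count_add]; exact Nat.le_add_left _ _
    _ ≤ (n + 3).primeCounting := Nat.count_monotone _ (by lia)

theorem stmt12 :
    (∀ y ∈ Set.Ioo (0 : ℝ) 1, Summable (fun n : ℕ => primeSeq (n + 3) * y ^ (n + 3))) ∧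
    Tendsto (fun y : ℝ => (1 - y) * ∑' n : ℕ, primeSeq (n + 3) * y ^ (n + 3))
      (𝓝[<] 1) (𝓝 0) := by
  refine ⟨fun y hy => ?_, ?_⟩
  · simpa only [pow_add, mul_assoc] using
      (summable_mul_pow_of_mem_Icc primeSeq_add_three_mem_Icc hy).mul_right (y ^ 3)
  · have hsq : Tendsto (fun y : ℝ => y ^ 2) (𝓝[<] 1) (𝓝 1) := by
      simpa using ((continuous_pow 2).tendsto (1 : ℝ)).mono_left nhdsWithin_le_nhds
    have h := hsq.mul (tendsto_one_sub_mul_tsum_of_isLittleO primeSeq_add_three_mem_Icc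
      sum_primeSeq_add_three_isLittleO)
    rw [mul_zero] at h
    refine h.congr fun y => ?_
    simp only [pow_add, ← mul_assoc, tsum_mul_right]
    ring
end
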